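/- Let A ∈ ℝ^{n×N} satisfy (i) the null space property of order s with constant 0 < ρ < 1: for every v ∈ ker A \ {0} and every S ⊆ {1,…,N} with |S| = s, Σ_{j∈S}|v_j| ≤ ρ·Σ_{j∈S^c}|v_j|; and (ii) the ℓ₁-quotient property with constant D > 0 relative to a norm ⦀·⦀ on ℝⁿ: for every w ∈ ℝⁿ there exists v ∈ ℝ^N with A v = w and ‖v‖₁ ≤ D^{−1}·⦀w⦀. Let x ∈ ℝ^N, w ∈ ℝⁿ, y = A x + w, and let x♯ be any minimizer of ‖z‖₁ over {z ∈ ℝ^N : A z = y}. Then ‖x♯ − x‖₁ ≤ (2(1+ρ)/(1−ρ))·σ_s(x)₁ + (2(1+ρ)/(D(1−ρ)))·⦀w⦀. -/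

import Mathlib

open scoped BigOperators

noncomputable section

/-- `nrm` is a norm on `ℝⁿ`. -/
def IsNormOn {n : ℕ} (nrm : (Fin n → ℝ) → ℝ) : Prop :=
  (∀ x, 0 ≤ nrm x) ∧ (∀ x, nrm x = 0 ↔ x = 0) ∧
  (∀ (c : ℝ) (x), nrm (c • x) = |c| * nrm x) ∧
  (∀ x y, nrm (x + y) ≤ nrm x + nrm y)

/-- The `ℓ₁` norm on `ℝ^N`. -/
def l1norm {N : ℕ} (v : Fin N → ℝ) : ℝ := ∑ j, |v j|

/-- `z` is `s`-sparse: it has at most `s` nonzero entries. -/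
def IsSparse {N : ℕ} (s : ℕ) (z : Fin N → ℝ) : Prop :=
  ∃ S : Finset (Fin N), S.card ≤ s ∧ ∀ j ∉ S, z j = 0

/-- The best `ℓ₁` approximation error of `x` by `s`-sparse vectors,
`σ_s(x)₁ = inf {‖x - z‖₁ : ‖z‖₀ ≤ s}`. -/
def sigmaS {N : ℕ} (s : ℕ) (x : Fin N → ℝ) : ℝ :=
  sInf {r : ℝ | ∃ z : Fin N → ℝ, IsSparse s z ∧ r = l1norm (x - z)}

/-- The scalar inequality behind noise-blind recovery: `U`, `V` are the `ℓ₁` masses of a kernel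
vector `v` on `S` and `Sᶜ`, `Q`, `P` those of `v + u`, and `a`, `b` those of `u`; `t` is the mass
of the signal on `Sᶜ`. -/
lemma recovery_scalar_bound {ρ U V Q P a b t : ℝ} (hρ0 : 0 < ρ) (hρ1 : ρ < 1)
    (ha : 0 ≤ a) (hUV : U ≤ ρ * V) (hV : V ≤ U + 2 * (t + b))
    (hP : P ≤ Q + 2 * t + a + b) (hQU : Q ≤ U + a) (hPV : P ≤ V + b) (hVP : V ≤ P + b) :
    Q + P ≤ 2 * (1 + ρ) / (1 - ρ) * (t + (a + b)) := by
  have h1 : 0 < 1 - ρ := by linarith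
  rw [div_mul_eq_mul_div, le_div_iff₀ h1]
  have hkerV : (1 - ρ) * V ≤ 2 * (t + b) := by linarith
  have hker : (1 - ρ) * (U + V) ≤ 2 * (1 + ρ) * (t + b) := by
    nlinarith [mul_le_mul_of_nonneg_left hkerV (by linarith : 0 ≤ 1 + ρ),
      mul_le_mul_of_nonneg_left hUV h1.le]
  have first : (1 - ρ) * (Q + P) ≤ 2 * (1 + ρ) * (t + b) + (1 - ρ) * (a + b) := by
    nlinarith [mul_le_mul_of_nonneg_left (add_le_add hQU hPV) h1.le]
  have hQ : Q ≤ ρ * P + ρ * b + a := by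
    nlinarith [mul_le_mul_of_nonneg_left hVP hρ0.le]
  have hP' : (1 - ρ) * P ≤ 2 * t + 2 * a + (1 + ρ) * b := by linarith
  have second : (1 - ρ) * (Q + P) ≤
      (1 + ρ) * (2 * t + 2 * a + (1 + ρ) * b) + (1 - ρ) * (ρ * b + a) := by
    nlinarith [mul_le_mul_of_nonneg_left hP' (by linarith : 0 ≤ 1 + ρ),
      mul_le_mul_of_nonneg_left hQ h1.le]
  nlinarith [mul_nonneg hρ0.le ha]

/-- If `‖z‖₁ ≤ ‖x + u‖₁` and `z - x - u` satisfies the null space inequality on `S`, then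
`‖z - x‖₁` is controlled by the mass of `x` off `S` and by `‖u‖₁`. -/
lemma l1norm_sub_le_of_nullSpace {N : ℕ} {ρ : ℝ} (hρ0 : 0 < ρ) (hρ1 : ρ < 1)
    (S : Finset (Fin N)) (x z u : Fin N → ℝ) (hle : l1norm z ≤ l1norm (x + u))
    (hS : ∑ j ∈ S, |(z - x - u) j| ≤ ρ * ∑ j ∈ Sᶜ, |(z - x - u) j|) :
    l1norm (z - x) ≤ 2 * (1 + ρ) / (1 - ρ) * (∑ j ∈ Sᶜ, |x j| + l1norm u) := by
  simp only [l1norm, Pi.sub_apply, Pi.add_apply] at *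
  rw [← Finset.sum_add_sum_compl S (fun j => |z j|),
    ← Finset.sum_add_sum_compl S (fun j => |x j + u j|)] at hle
  rw [← Finset.sum_add_sum_compl S (fun j => |z j - x j|),
    ← Finset.sum_add_sum_compl S (fun j => |u j|)]
  have e1 : ∑ j ∈ S, |x j + u j| ≤ ∑ j ∈ S, |z j| + ∑ j ∈ S, |z j - x j - u j| := by
    rw [← Finset.sum_add_distrib]
    refine Finset.sum_le_sum fun j _ => ?_
    have := abs_sub (z j) (z j - x j - u j)
    rwa [show z j - (z j - x j - u j) = x j + u j by ring] at this
  have e2 : ∑ j ∈ Sᶜ, |x j + u j| ≤ ∑ j ∈ Sᶜ, |x j| + ∑ j ∈ Sᶜ, |u j| := by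
    rw [← Finset.sum_add_distrib]
    exact Finset.sum_le_sum fun j _ => abs_add_le _ _
  have e3 : ∑ j ∈ Sᶜ, |z j - x j - u j| ≤ ∑ j ∈ Sᶜ, |z j| + ∑ j ∈ Sᶜ, |x j + u j| := by
    rw [← Finset.sum_add_distrib]
    refine Finset.sum_le_sum fun j _ => ?_
    rw [sub_sub]
    exact abs_sub _ _
  have e4 : ∑ j ∈ Sᶜ, |z j - x j| ≤ ∑ j ∈ Sᶜ, |z j| + ∑ j ∈ Sᶜ, |x j| := by
    rw [← Finset.sum_add_distrib]
    exact Finset.sum_le_sum fun j _ => abs_sub _ _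
  have e5 (T : Finset (Fin N)) :
      ∑ j ∈ T, |z j - x j| ≤ ∑ j ∈ T, |z j - x j - u j| + ∑ j ∈ T, |u j| := by
    rw [← Finset.sum_add_distrib]
    refine Finset.sum_le_sum fun j _ => ?_
    have := abs_add_le (z j - x j - u j) (u j)
    rwa [sub_add_cancel] at this
  have e6 : ∑ j ∈ Sᶜ, |z j - x j - u j| ≤ ∑ j ∈ Sᶜ, |z j - x j| + ∑ j ∈ Sᶜ, |u j| := by
    rw [← Finset.sum_add_distrib]
    exact Finset.sum_le_sum fun j _ => abs_sub _ _
  have e7 : ∑ j ∈ S, |x j + u j| ≤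
      ∑ j ∈ S, |z j| + (∑ j ∈ S, |z j - x j| + ∑ j ∈ S, |u j|) := by
    rw [← Finset.sum_add_distrib, ← Finset.sum_add_distrib]
    refine Finset.sum_le_sum fun j _ => ?_
    have := abs_sub (z j) (z j - x j)
    rw [sub_sub_cancel] at this
    linarith [abs_add_le (x j) (u j)]
  exact recovery_scalar_bound hρ0 hρ1 (Finset.sum_nonneg fun j _ => abs_nonneg _) hS
    (by linarith) (by linarith) (e5 S) (e5 Sᶜ) e6

/-- A lower bound for the mass of `x` off every set of size `s` is a lower bound for
`σ_s(x)₁`. -/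
lemma le_sigmaS {N s : ℕ} (hsN : s ≤ N) (x : Fin N → ℝ) {c : ℝ}
    (hc : ∀ S : Finset (Fin N), S.card = s → c ≤ ∑ j ∈ Sᶜ, |x j|) : c ≤ sigmaS s x := by
  refine le_csInf ⟨_, 0, ⟨∅, by simp, by simp⟩, rfl⟩ ?_
  rintro _ ⟨z, ⟨T, hT, hz⟩, rfl⟩
  obtain ⟨S, hTS, hS⟩ := Finset.exists_superset_card_eq hT (by simpa using hsN)
  refine (hc S hS).trans ?_
  calc ∑ j ∈ Sᶜ, |x j| = ∑ j ∈ Sᶜ, |(x - z) j| := by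
        refine Finset.sum_congr rfl fun j hj => ?_
        rw [Pi.sub_apply, hz j fun h => Finset.mem_compl.1 hj (hTS h), sub_zero]
    _ ≤ l1norm (x - z) :=
        Finset.sum_le_univ_sum_of_nonneg fun j => abs_nonneg _

/-- noise-blind recovery, Appendix B: if `A` satisfies the null space
property of order `s` with constant `ρ < 1` and the `ℓ₁`-quotient property with constant `D`
relative to a norm `⦀·⦀`, then any `ℓ₁`-minimizer `x♯` with data `y = Ax + w` satisfies
`‖x♯ - x‖₁ ≤ (2(1+ρ)/(1-ρ)) σ_s(x)₁ + (2(1+ρ)/(D(1-ρ))) ⦀w⦀`. -/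
theorem stmt19 {n N : ℕ} (A : Matrix (Fin n) (Fin N) ℝ)
    (s : ℕ) (hsN : s ≤ N) (ρ : ℝ) (hρ0 : 0 < ρ) (hρ1 : ρ < 1)
    -- null space property of order `s` with constant `ρ`
    (hNSP : ∀ v : Fin N → ℝ, A.mulVec v = 0 → v ≠ 0 →
      ∀ S : Finset (Fin N), S.card = s →
        ∑ j ∈ S, |v j| ≤ ρ * ∑ j ∈ Sᶜ, |v j|)
    (nrm : (Fin n → ℝ) → ℝ) (hnrm : IsNormOn nrm)
    (D : ℝ) (hD : 0 < D)
    -- `ℓ₁`-quotient property with constant `D` relative to `nrm`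
    (hquot : ∀ w : Fin n → ℝ, ∃ v : Fin N → ℝ, A.mulVec v = w ∧ l1norm v ≤ D⁻¹ * nrm w)
    (x xs : Fin N → ℝ) (w : Fin n → ℝ) (y : Fin n → ℝ) (hy : y = A.mulVec x + w)
    -- `xs` is a minimizer of the `ℓ₁` norm subject to `A z = y`
    (hfeas : A.mulVec xs = y)
    (hmin : ∀ z : Fin N → ℝ, A.mulVec z = y → l1norm xs ≤ l1norm z) :
    l1norm (xs - x) ≤
      (2 * (1 + ρ) / (1 - ρ)) * sigmaS s x + (2 * (1 + ρ) / (D * (1 - ρ))) * nrm w := by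
  obtain ⟨u, hu, hun⟩ := hquot w
  have h1 : 0 < 1 - ρ := by linarith
  have hC : 0 < 2 * (1 + ρ) / (1 - ρ) := by positivity
  have hAu : A.mulVec (x + u) = y := by rw [Matrix.mulVec_add, hu, hy]
  have hker : A.mulVec (xs - x - u) = 0 := by
    rw [sub_sub, Matrix.mulVec_sub, hAu, hfeas, sub_self]
  have hσ : l1norm (xs - x) / (2 * (1 + ρ) / (1 - ρ)) - l1norm u ≤ sigmaS s x := by
    refine le_sigmaS hsN x fun S hS => ?_
    rw [sub_le_iff_le_add, div_le_iff₀' hC]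
    refine l1norm_sub_le_of_nullSpace hρ0 hρ1 S x xs u (hmin _ hAu) ?_
    by_cases hv : xs - x - u = 0
    · rw [hv]; simp
    · exact hNSP _ hker hv S hS
  rw [sub_le_iff_le_add, div_le_iff₀' hC] at hσ
  calc l1norm (xs - x) ≤ 2 * (1 + ρ) / (1 - ρ) * (sigmaS s x + l1norm u) := hσ
    _ ≤ 2 * (1 + ρ) / (1 - ρ) * (sigmaS s x + D⁻¹ * nrm w) := by gcongr
    _ = _ := by field_simp
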